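/- arXiv:2105.14365 — 3 statements merged into one kernel-verified Lean document; each statement's English description precedes it below -/
import Mathlib

section
/- Let G be a finite group of order 240 having exactly one element of order 2 and possessing a normal subgroup N isomorphic to SL(2,5) (these conditions characterize the non-split extension SL(2,5).C_2). Then the center of G has order 2 and is contained in N. -/
open Matrix in
def slEquivAux : Matrix.SpecialLinearGroup (Fin 2) (ZMod 5) ≃
    {p : (ZMod 5 × ZMod 5) × (ZMod 5 × ZMod 5) // p.1.1 * p.2.2 - p.1.2 * p.2.1 = 1} where
  toFun A := ⟨((A.1 0 0, A.1 0 1), (A.1 1 0, A.1 1 1)), by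
    have h := A.2
    rw [Matrix.det_fin_two] at h
    exact h⟩
  invFun p := ⟨!![p.1.1.1, p.1.1.2; p.1.2.1, p.1.2.2], by
    rw [Matrix.det_fin_two_of]; exact p.2⟩
  left_inv A := by
    ext i j
    fin_cases i <;> fin_cases j <;> rfl
  right_inv p := by
    rfl

set_option maxRecDepth 100000 in
set_option maxHeartbeats 4000000 in
theorem card_sl_aux : Nat.card (Matrix.SpecialLinearGroup (Fin 2) (ZMod 5)) = 120 := by
  rw [Nat.card_congr slEquivAux, Nat.card_eq_fintype_card]
  decide +kernel

theorem sl_center_aux (A : Matrix.SpecialLinearGroup (Fin 2) (ZMod 5))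
    (h : ∀ B, A * B = B * A) : A = 1 ∨ A = -1 := by
  have h1 : A.1 * !![1, 1; 0, 1] = !![1, 1; 0, 1] * A.1 := congrArg Subtype.val (h ⟨!![1, 1; 0, 1], by simp⟩)
  have h2 : A.1 * !![1, 0; 1, 1] = !![1, 0; 1, 1] * A.1 := congrArg Subtype.val (h ⟨!![1, 0; 1, 1], by simp⟩)
  have hd := A.2
  rw [Matrix.det_fin_two] at hd
  have e1 := congrFun (congrFun h1 0) 0
  have e2 := congrFun (congrFun h1 0) 1
  have e3 := congrFun (congrFun h2 0) 0
  simp [Matrix.mul_apply, Fin.sum_univ_two] at e1 e2 e3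
  have key : ∀ a b c d : ZMod 5, c = 0 → b = 0 → a = d → a * d - b * c = 1 →
      (a = 1 ∧ b = 0 ∧ c = 0 ∧ d = 1) ∨ (a = -1 ∧ b = 0 ∧ c = 0 ∧ d = -1) := by
    decide +kernel
  have hc : A.1 1 0 = 0 := by linear_combination e1
  have hb : A.1 0 1 = 0 := by linear_combination e3
  have had : A.1 0 0 = A.1 1 1 := by linear_combination e2
  rcases key _ _ _ _ hc hb had hd with ⟨a, b, c, d⟩ | ⟨a, b, c, d⟩
  · left
    ext i j
    fin_cases i <;> fin_cases j <;> simp [a, b, c, d]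
  · right
    ext i j
    fin_cases i <;> fin_cases j <;> simp [a, b, c, d]

theorem sl_exists_aux : ∃ i : Matrix.SpecialLinearGroup (Fin 2) (ZMod 5),
    i * i = -1 := by
  refine ⟨⟨!![0, 1; -1, 0], by simp⟩, ?_⟩
  apply Subtype.ext
  change (!![0, 1; -1, 0] * !![0, 1; -1, 0] : Matrix (Fin 2) (Fin 2) (ZMod 5)) = -1
  decide +kernel

theorem sl_neg_one_ne_aux : (-1 : Matrix.SpecialLinearGroup (Fin 2) (ZMod 5)) ≠ 1 := by
  intro h
  have h1 := congrFun (congrFun (congrArg Subtype.val h) 0) 0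
  simp at h1
  revert h1
  decide

/-- If `G` has order 240, exactly one element of order 2, and a normal subgroup `N`
isomorphic to `SL(2,5)` (i.e. `G` is the non-split extension `SL(2,5).C₂`), then the
center of `G` has order 2 and is contained in `N`. -/
theorem stmt8 {G : Type*} [Group G] [Finite G]
    (hcard : Nat.card G = 240)
    (huniq : ∃! g : G, orderOf g = 2)
    (N : Subgroup G) (hN : N.Normal)
    (hiso : Nonempty (N ≃* Matrix.SpecialLinearGroup (Fin 2) (ZMod 5))) :
    Nat.card (Subgroup.center G) = 2 ∧ Subgroup.center G ≤ N := by
  obtain ⟨f⟩ := hiso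
  have hNc : Nat.card N = 120 := by rw [Nat.card_congr f.toEquiv, card_sl_aux]
  have hidx : N.index = 2 := by
    have := N.card_mul_index
    rw [hNc, hcard] at this
    omega
  have inv_eq : ∀ g h : G, g * g = 1 → g ≠ 1 → h * h = 1 → h ≠ 1 → g = h := by
    intro g h hg hg1 hh hh1
    refine huniq.unique ?_ ?_
    · exact orderOf_eq_prime (by rw [pow_two, hg]) hg1
    · exact orderOf_eq_prime (by rw [pow_two, hh]) hh1
  -- the involution
  set w : N := f.symm (-1) with hw
  have hww : w * w = 1 := by
    rw [hw, ← map_mul]; simp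
  have hw1 : w ≠ 1 := by
    intro h
    apply sl_neg_one_ne_aux
    rw [← f.apply_symm_apply (-1), ← hw, h, map_one]
  have hwwG : (w : G) * w = 1 := by exact_mod_cast congrArg Subtype.val hww
  have hw1G : (w : G) ≠ 1 := by exact_mod_cast hw1
  obtain ⟨i, hi⟩ := sl_exists_aux
  have hiw : ((f.symm i : N) : G) * (f.symm i : N) = w := by
    rw [hw, ← hi, map_mul]; rfl
  have cenN : ∀ z ∈ Subgroup.center G, z ∈ N → z = 1 ∨ z = w := by
    intro z hz hzN
    have := sl_center_aux (f ⟨z, hzN⟩) (by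
      intro B
      rw [← f.apply_symm_apply B, ← map_mul, ← map_mul]
      congr 1
      apply Subtype.ext
      exact (Subgroup.mem_center_iff.1 hz _).symm)
    rcases this with h | h
    · left
      have h' : (⟨z, hzN⟩ : N) = 1 := by
        apply f.injective; rw [h, map_one]
      exact congrArg Subtype.val h'
    · right
      have h' : (⟨z, hzN⟩ : N) = w := by
        apply f.injective; rw [h, hw, f.apply_symm_apply]
      exact congrArg Subtype.val h'
  have hle : Subgroup.center G ≤ N := by
    intro z hz
    by_contra hzN
    have hz2 : z * z ∈ N := Subgroup.mul_self_mem_of_index_two hidx z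
    rcases cenN (z * z) (mul_mem hz hz) hz2 with h | h
    · have := inv_eq z w h (by rintro rfl; exact hzN N.one_mem) hwwG hw1G
      exact hzN (this ▸ w.2)
    · set j : G := ((f.symm i : N) : G) with hj
      have hjN : j ∈ N := (f.symm i).2
      have hzj : z * j ∉ N := fun h' => hzN ((N.mul_mem_cancel_right hjN).1 h')
      have hc : j * z = z * j := Subgroup.mem_center_iff.1 hz j
      have hsq : (z * j) * (z * j) = 1 := by
        calc (z * j) * (z * j) = z * (j * z) * j := by group
          _ = (z * z) * (j * j) := by rw [hc]; group
          _ = 1 := by rw [h, hiw, hwwG]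
      have := inv_eq (z * j) w hsq (by intro h'; exact hzj (h' ▸ N.one_mem)) hwwG hw1G
      exact hzj (this ▸ w.2)
  refine ⟨?_, hle⟩
  have hwc : (w : G) ∈ Subgroup.center G := by
    rw [Subgroup.mem_center_iff]
    intro g
    have : g * w * g⁻¹ = w := by
      apply inv_eq _ _ _ _ hwwG hw1G
      · calc g * w * g⁻¹ * (g * w * g⁻¹) = g * (w * w) * g⁻¹ := by group
          _ = 1 := by rw [hwwG]; group
      · intro h
        apply hw1G
        exact conj_eq_one_iff.1 h
    exact mul_inv_eq_iff_eq_mul.1 this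
  have hset : (Subgroup.center G : Set G) = {1, (w : G)} := by
    ext z
    constructor
    · intro hz
      exact cenN z hz (hle hz)
    · rintro (rfl | rfl)
      · exact one_mem _
      · exact hwc
  have : Nat.card (Subgroup.center G) = (Subgroup.center G : Set G).ncard := rfl
  rw [this, hset, Set.ncard_pair hw1G.symm]
end

section
/- Let G be a finite group of order 240 having exactly one element of order 2 and possessing a normal subgroup N isomorphic to SL(2,5) (these conditions characterize the non-split extension SL(2,5).C_2). Then the quotient of G by its center is isomorphic to the symmetric group S_5. -/
open Matrix
abbrev S25 := Matrix.SpecialLinearGroup (Fin 2) (ZMod 5)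

/-- entrywise relation on trace-zero matrices -/
def relE (a b c a' b' c' : ZMod 5) : Bool :=
  2*a*a'+b*c'+c*b' == 0 || (a == a' && b == b' && c == c') || (a == -a' && b == -b' && c == -c')

def cl (a b c : ZMod 5) : Fin 5 :=
  if relE a b c 0 1 4 then 0 else if relE a b c 1 1 3 then 1 else if relE a b c 1 2 4 then 2 else
  if relE a b c 1 3 1 then 3 else 4

def rp : Fin 5 → ZMod 5 × ZMod 5 × ZMod 5 := ![(0,1,4),(1,1,3),(1,2,4),(1,3,1),(1,4,2)]

lemma cl_rp : ∀ i, cl (rp i).1 (rp i).2.1 (rp i).2.2 = i := by decide +kernel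
lemma rp_det : ∀ i, (rp i).1 * (-(rp i).1) - (rp i).2.1 * (rp i).2.2 = 1 := by decide +kernel

lemma cl_rel : ∀ a b c : ZMod 5, a*a+b*c = -1 → ∀ a' b' c' : ZMod 5, a'*a'+b'*c' = -1 →
    (cl a b c = cl a' b' c' ↔ relE a b c a' b' c' = true) := by decide +kernel

lemma relE_iff : ∀ a b c : ZMod 5, a*a+b*c = -1 → ∀ a' b' c' : ZMod 5, a'*a'+b'*c' = -1 →
    (relE a b c a' b' c' = true ↔
     ((a*a'+b*c' = a'*a+b'*c ∧ a*b'+b*(-a') = a'*b+b'*(-a) ∧ c*a'+(-a)*c' = c'*a+(-a')*c ∧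
       c*b'+(-a)*(-a') = c'*b + (-a')*(-a)) ∨
      (a*a'+b*c' = -(a'*a+b'*c) ∧ a*b'+b*(-a') = -(a'*b+b'*(-a)) ∧ c*a'+(-a)*c' = -(c'*a+(-a')*c) ∧
       c*b'+(-a)*(-a') = -(c'*b + (-a')*(-a))))) := by decide +kernel

lemma tr0 : ∀ a b c d : ZMod 5, a*d-b*c=1 → a*a+b*c=-1 → a*b+b*d=0 → c*a+d*c=0 → d = -a := by
  decide +kernel

lemma ord2 : ∀ a b c d : ZMod 5, a*d-b*c=1 → a*a+b*c=1 → a*b+b*d=0 → c*a+d*c=0 → c*b+d*d=1 →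
   (a = 1 ∧ b = 0 ∧ c = 0 ∧ d = 1) ∨ (a = -1 ∧ b = 0 ∧ c = 0 ∧ d = -1) := by
  decide +kernel
-- s x s⁻¹, x = (p,q;r,-p), s⁻¹ = (d,-b;-c,a)
lemma ker_dec : ∀ a b c d : ZMod 5, a*d-b*c=1 →
   (∀ i : Fin 5, cl ((a*(rp i).1+b*(rp i).2.2)*d + (a*(rp i).2.1+b*(-(rp i).1))*(-c))
     ((a*(rp i).1+b*(rp i).2.2)*(-b) + (a*(rp i).2.1+b*(-(rp i).1))*a)
     ((c*(rp i).1+d*(rp i).2.2)*d + (c*(rp i).2.1+d*(-(rp i).1))*(-c)) = i) →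
   (a = 1 ∧ b = 0 ∧ c = 0 ∧ d = 1) ∨ (a = -1 ∧ b = 0 ∧ c = 0 ∧ d = -1) := by
  decide +kernel

lemma S_ext {x y : S25} : x = y ↔ x 0 0 = y 0 0 ∧ x 0 1 = y 0 1 ∧ x 1 0 = y 1 0 ∧ x 1 1 = y 1 1 := by
  constructor
  · rintro rfl; simp
  · rintro ⟨h1,h2,h3,h4⟩
    ext i j; fin_cases i <;> fin_cases j <;> assumption

lemma S_mul (x y : S25) : (x*y) 0 0 = x 0 0 * y 0 0 + x 0 1 * y 1 0 ∧
   (x*y) 0 1 = x 0 0 * y 0 1 + x 0 1 * y 1 1 ∧ (x*y) 1 0 = x 1 0 * y 0 0 + x 1 1 * y 1 0 ∧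
   (x*y) 1 1 = x 1 0 * y 0 1 + x 1 1 * y 1 1 := by
  simp [Matrix.mul_apply, Fin.sum_univ_two]

lemma S_inv (x : S25) : x⁻¹ 0 0 = x 1 1 ∧ x⁻¹ 0 1 = - x 0 1 ∧ x⁻¹ 1 0 = - x 1 0 ∧ x⁻¹ 1 1 = x 0 0 := by
  simp [Matrix.adjugate_fin_two]

lemma S_neg (x : S25) (i j) : (-x) i j = - x i j := by simp

lemma S_one : (1:S25) 0 0 = 1 ∧ (1:S25) 0 1 = 0 ∧ (1:S25) 1 0 = 0 ∧ (1:S25) 1 1 = 1 := by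
  simp

lemma S_det (x : S25) : x 0 0 * x 1 1 - x 0 1 * x 1 0 = 1 := by
  have := x.2; rw [Matrix.det_fin_two] at this; exact this

lemma S_eq_pm {x : S25} (h : (x 0 0 = 1 ∧ x 0 1 = 0 ∧ x 1 0 = 0 ∧ x 1 1 = 1) ∨
    (x 0 0 = -1 ∧ x 0 1 = 0 ∧ x 1 0 = 0 ∧ x 1 1 = -1)) : x = 1 ∨ x = -1 := by
  rcases h with h | h
  · left; rw [S_ext]; simpa using h
  · right; rw [S_ext]; simpa using h

lemma S_sq_one {x : S25} (h : x * x = 1) : x = 1 ∨ x = -1 := by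
  obtain ⟨m1,m2,m3,m4⟩ := S_mul x x
  obtain ⟨o1,o2,o3,o4⟩ := S_one
  rw [h, o1] at m1; rw [h, o2] at m2; rw [h, o3] at m3; rw [h, o4] at m4
  exact S_eq_pm (ord2 _ _ _ _ (S_det x) m1.symm m2.symm m3.symm m4.symm)

lemma one_ne_neg : (1:S25) ≠ -1 := by
  intro h
  have := (S_ext.1 h).1
  simp at this
  revert this; decide

lemma aut_neg_one (α : MulAut S25) : α (-1) = -1 := by
  have h : α (-1) * α (-1) = 1 := by rw [← map_mul]; simp
  rcases S_sq_one h with h | h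
  · exfalso
    have : α (-1) = α 1 := by simpa using h
    exact one_ne_neg (α.injective this).symm
  · exact h

lemma aut_neg (α : MulAut S25) (x : S25) : α (-x) = - α x := by
  rw [← neg_one_mul, map_mul, aut_neg_one, neg_one_mul]

lemma sq_entries {x : S25} (h : x * x = -1) :
    x 1 1 = - x 0 0 ∧ x 0 0 * x 0 0 + x 0 1 * x 1 0 = -1 := by
  obtain ⟨m1,m2,m3,m4⟩ := S_mul x x
  obtain ⟨o1,o2,o3,o4⟩ := S_one
  rw [h, S_neg, o1] at m1; rw [h, S_neg, o2, neg_zero] at m2; rw [h, S_neg, o3, neg_zero] at m3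
  exact ⟨tr0 _ _ _ _ (S_det x) m1.symm m2.symm m3.symm, m1.symm⟩

def cls (x : S25) : Fin 5 := cl (x 0 0) (x 0 1) (x 1 0)

lemma cls_eq_iff {x y : S25} (hx : x * x = -1) (hy : y * y = -1) :
    cls x = cls y ↔ (x * y = y * x ∨ x * y = -(y * x)) := by
  obtain ⟨x1, x2⟩ := sq_entries hx
  obtain ⟨y1, y2⟩ := sq_entries hy
  obtain ⟨m1,m2,m3,m4⟩ := S_mul x y
  obtain ⟨n1,n2,n3,n4⟩ := S_mul y x
  rw [cls, cls, cl_rel _ _ _ x2 _ _ _ y2, relE_iff _ _ _ x2 _ _ _ y2, S_ext, S_ext]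
  simp only [S_neg]
  rw [m1,m2,m3,m4,n1,n2,n3,n4,x1,y1]

def rpS (i : Fin 5) : S25 :=
  ⟨!![(rp i).1, (rp i).2.1; (rp i).2.2, -(rp i).1], by rw [Matrix.det_fin_two]; exact rp_det i⟩

lemma rpS_e (i : Fin 5) : rpS i 0 0 = (rp i).1 ∧ rpS i 0 1 = (rp i).2.1 ∧ rpS i 1 0 = (rp i).2.2 ∧
  rpS i 1 1 = - (rp i).1 := ⟨rfl, rfl, rfl, rfl⟩

lemma cls_rpS (i : Fin 5) : cls (rpS i) = i := cl_rp i

lemma rpS_sq (i : Fin 5) : rpS i * rpS i = -1 := by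
  have h := rp_det i
  rw [S_ext]
  obtain ⟨m1,m2,m3,m4⟩ := S_mul (rpS i) (rpS i)
  obtain ⟨o1,o2,o3,o4⟩ := S_one
  obtain ⟨r1,r2,r3,r4⟩ := rpS_e i
  simp only [S_neg]
  rw [m1,m2,m3,m4,o1,o2,o3,o4,r1,r2,r3,r4]
  exact ⟨by linear_combination -h, by ring, by ring, by linear_combination -h⟩

lemma S_card : Nat.card S25 = 120 := by
  let f : S25 ≃ {p : ZMod 5 × ZMod 5 × ZMod 5 × ZMod 5 // p.1 * p.2.2.2 - p.2.1 * p.2.2.1 = 1} :=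
    { toFun := fun x => ⟨(x 0 0, x 0 1, x 1 0, x 1 1), S_det x⟩
      invFun := fun p => ⟨!![p.1.1, p.1.2.1; p.1.2.2.1, p.1.2.2.2], by
        rw [Matrix.det_fin_two]; exact p.2⟩
      left_inv := fun x => S_ext.2 ⟨rfl, rfl, rfl, rfl⟩
      right_inv := fun p => rfl }
  rw [Nat.card_congr f, Nat.card_eq_fintype_card]
  decide +kernel

lemma aut_sq (α : MulAut S25) {x : S25} (h : x * x = -1) : α x * α x = -1 := by
  rw [← map_mul, h, aut_neg_one]

lemma aut_cls (α : MulAut S25) {x y : S25} (hx : x * x = -1) (hy : y * y = -1)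
    (h : cls x = cls y) : cls (α x) = cls (α y) := by
  rw [cls_eq_iff hx hy] at h
  rw [cls_eq_iff (aut_sq α hx) (aut_sq α hy), ← map_mul, ← map_mul, ← aut_neg]
  rcases h with h | h
  · left; rw [h]
  · right; rw [h]

/-- The automorphism group permutes the five classes. -/
def thetaEnd : MulAut S25 →* Function.End (Fin 5) where
  toFun α := fun i => cls (α (rpS i))
  map_one' := by funext i; exact cls_rpS i
  map_mul' α β := by
    funext i
    exact aut_cls α (aut_sq β (rpS_sq i)) (rpS_sq _) (cls_rpS _).symm

def theta : MulAut S25 →* Equiv.Perm (Fin 5) := thetaEnd.toHomPerm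

lemma theta_apply (α : MulAut S25) (i : Fin 5) : theta α i = cls (α (rpS i)) := rfl

lemma theta_conj {s : S25} (h : theta (MulAut.conj s) = 1) : s = 1 ∨ s = -1 := by
  apply S_eq_pm
  apply ker_dec _ _ _ _ (S_det s)
  intro i
  have hi : cls (s * rpS i * s⁻¹) = i := by
    have := theta_apply (MulAut.conj s) i
    rw [h] at this
    exact this.symm
  rw [cls] at hi
  obtain ⟨m1,m2,m3,m4⟩ := S_mul (s * rpS i) s⁻¹
  obtain ⟨n1,n2,n3,n4⟩ := S_mul s (rpS i)
  obtain ⟨o1,o2,o3,o4⟩ := S_inv s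
  obtain ⟨r1,r2,r3,r4⟩ := rpS_e i
  rw [m1,m2,m3,n1,n2,n3,n4,o1,o2,o3,o4,r1,r2,r3,r4] at hi
  exact hi

def uU : S25 := ⟨!![1,1;0,1], by decide⟩
def uL : S25 := ⟨!![1,0;-1,1], by decide⟩

lemma uU_pow : uU ^ 5 = 1 := by
  rw [S_ext]; decide
lemma uL_pow : uL ^ 5 = 1 := by
  rw [S_ext]; decide
lemma w_sq : (uU * uL * uU) * (uU * uL * uU) = -1 := by
  rw [S_ext]; decide

lemma aut_fix {α : MulAut S25} (h : ∀ s, α s = s ∨ α s = -s) {u : S25} (hu : u ^ 5 = 1) :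
    α u = u := by
  rcases h u with h | h
  · exact h
  · exfalso
    have h1 : (α u) ^ 5 = 1 := by rw [← map_pow, hu, map_one]
    rw [h, Odd.neg_pow (by decide), hu] at h1
    exact one_ne_neg h1.symm


/-- If `G` has order 240, exactly one element of order 2, and a normal subgroup `N`
isomorphic to `SL(2,5)` (i.e. `G` is the non-split extension `SL(2,5).C₂`), then the
quotient of `G` by its center is isomorphic to the symmetric group `S₅`. -/
theorem stmt9 {G : Type*} [Group G] [Finite G]
    (hcard : Nat.card G = 240)
    (huniq : ∃! g : G, orderOf g = 2)
    (N : Subgroup G) (hN : N.Normal)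
    (hiso : Nonempty (N ≃* Matrix.SpecialLinearGroup (Fin 2) (ZMod 5))) :
    Nonempty ((G ⧸ Subgroup.center G) ≃* Equiv.Perm (Fin 5)) := by
  obtain ⟨e⟩ := hiso
  let ψ : S25 →* G := N.subtype.comp e.symm.toMonoidHom
  let φ : G →* MulAut S25 := (MulAut.congr e).toMonoidHom.comp MulAut.conjNormal
  have hψN : ∀ s, ψ s ∈ N := fun s => (e.symm s).2
  have hψinj : Function.Injective ψ := fun a b h => e.symm.injective (Subtype.ext h)
  have hψsurj : ∀ g ∈ N, ∃ s, ψ s = g := fun g hg => ⟨e ⟨g, hg⟩, by simp [ψ]⟩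
  have hφ : ∀ g s, ψ (φ g s) = g * ψ s * g⁻¹ := by
    intro g s
    simp [ψ, φ, MulAut.congr]
  have hφψ : ∀ s, φ (ψ s) = MulAut.conj s := by
    intro s
    ext1 t
    apply hψinj
    rw [hφ]; simp
  have hz2 : ψ (-1) * ψ (-1) = 1 := by rw [← map_mul]; simp
  have hz1 : ψ (-1) ≠ 1 := fun h => one_ne_neg (hψinj (by rw [h, map_one])).symm
  have hinv : ∀ g : G, g * g = 1 → g = 1 ∨ g = ψ (-1) := by
    intro g hg
    by_cases h1 : g = 1
    · exact Or.inl h1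
    · right
      exact huniq.unique (orderOf_eq_prime (by rw [pow_two, hg]) h1)
        (orderOf_eq_prime (by rw [pow_two, hz2]) hz1)
  let Θ : G →* Equiv.Perm (Fin 5) := theta.comp φ
  have hKN : ∀ s, Θ (ψ s) = 1 → s = 1 ∨ s = -1 := by
    intro s hs
    apply theta_conj
    rw [← hφψ]; exact hs
  have hcN : Nat.card N = 120 := by rw [Nat.card_congr e.toEquiv]; exact S_card
  have hidx : N.index = 2 := by
    have := N.card_mul_index
    rw [hcN, hcard] at this
    omega
  have hKle : ∀ k, Θ k = 1 → k ∈ N := by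
    intro k hk
    by_contra hkN
    have hkk : k * k = ψ (-1) := by
      obtain ⟨s, hs⟩ := hψsurj _ (Subgroup.mul_self_mem_of_index_two hidx k)
      rcases hKN s (by rw [hs, map_mul, hk, one_mul]) with h | h
      · rw [h, map_one] at hs
        rcases hinv k hs.symm with h | h
        · exact absurd (h ▸ N.one_mem) hkN
        · exact absurd (h ▸ hψN _) hkN
      · rw [← hs, h]
    have hpm : ∀ s, φ k s = s ∨ φ k s = -s := by
      intro s
      have : Θ (ψ (φ k s * s⁻¹)) = 1 := by
        rw [map_mul, hφ]
        simp [hk]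
      rcases hKN _ this with h | h
      · left; exact mul_inv_eq_one.1 h
      · right; rw [mul_inv_eq_iff_eq_mul.1 h, neg_one_mul]
    have hw : φ k (uU * uL * uU) = uU * uL * uU := by
      rw [map_mul, map_mul, aut_fix hpm uU_pow, aut_fix hpm uL_pow]
    have hcomm : k * ψ (uU * uL * uU) = ψ (uU * uL * uU) * k := by
      have := hφ k (uU * uL * uU)
      rw [hw] at this
      exact (eq_mul_inv_iff_mul_eq.1 this).symm
    have hsq : (k * ψ (uU * uL * uU)) * (k * ψ (uU * uL * uU)) = 1 := by
      calc _ = k * (ψ (uU * uL * uU) * k) * ψ (uU * uL * uU) := by group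
        _ = (k * k) * (ψ (uU * uL * uU) * ψ (uU * uL * uU)) := by rw [← hcomm]; group
        _ = 1 := by rw [hkk, ← map_mul, w_sq, hz2]
    have hmem : k * ψ (uU * uL * uU) ∈ N := by
      rcases hinv _ hsq with h | h
      · rw [h]; exact N.one_mem
      · rw [h]; exact hψN _
    exact hkN ((N.mul_mem_cancel_right (hψN _)).1 hmem)
  have hK : ∀ k, Θ k = 1 → k = 1 ∨ k = ψ (-1) := by
    intro k hk
    obtain ⟨s, rfl⟩ := hψsurj k (hKle k hk)
    rcases hKN s hk with h | h
    · left; rw [h, map_one]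
    · right; rw [h]
  have hzc : ψ (-1) ∈ Subgroup.center G := by
    rw [Subgroup.mem_center_iff]
    intro g
    have := hφ g (-1)
    rw [aut_neg_one] at this
    exact (eq_mul_inv_iff_mul_eq.1 this).symm
  have hcφ : ∀ g ∈ Subgroup.center G, Θ g = 1 := by
    intro g hg
    have : φ g = 1 := by
      ext1 t
      apply hψinj
      rw [hφ, ← Subgroup.mem_center_iff.1 hg]
      simp
    change theta (φ g) = 1
    rw [this, map_one]
  have hker : Subgroup.center G = Θ.ker := by
    ext g
    rw [MonoidHom.mem_ker]
    refine ⟨hcφ g, fun h => ?_⟩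
    rcases hK g h with h | h
    · rw [h]; exact Subgroup.one_mem _
    · rw [h]; exact hzc
  have hkc : Nat.card Θ.ker = 2 := by
    have hset : (Θ.ker : Set G) = {1, ψ (-1)} := by
      ext g
      simp only [SetLike.mem_coe, MonoidHom.mem_ker, Set.mem_insert_iff, Set.mem_singleton_iff]
      refine ⟨hK g, ?_⟩
      rintro (h | h)
      · rw [h, map_one]
      · rw [h]; exact hcφ _ hzc
    have : Nat.card (Θ.ker : Set G) = 2 := by
      rw [hset, Nat.card_coe_set_eq, Set.ncard_pair hz1.symm]
    exact this
  have hq : Nat.card (G ⧸ Θ.ker) = 120 := by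
    have := Subgroup.card_eq_card_quotient_mul_card_subgroup Θ.ker
    rw [hkc, hcard] at this
    omega
  have hbij : Function.Bijective (QuotientGroup.kerLift Θ) := by
    rw [Nat.bijective_iff_injective_and_card]
    refine ⟨QuotientGroup.kerLift_injective Θ, ?_⟩
    rw [hq, Nat.card_eq_fintype_card, Fintype.card_perm]
    rfl
  exact ⟨(QuotientGroup.quotientMulEquivOfEq hker).trans (MulEquiv.ofBijective _ hbij)⟩
end

section
/- Let G be a finite group of order 240 having exactly one element of order 2 and possessing a normal subgroup N isomorphic to SL(2,5) (these conditions characterize the non-split extension SL(2,5).C_2). Then there exist subgroups H_1 and H_2 of G such that H_1 is isomorphic to the generalized quaternion group Q_16 of order 16, H_2 is isomorphic to the dicyclic group of order 24, the intersection H_1 ∩ H_2 contains a subgroup isomorphic to the quaternion group Q_8 of order 8, and H_1 together with H_2 generate G. -/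
/-! ### 2×2 matrices over `ZMod 5` as 4-tuples -/

abbrev SL25 := Matrix.SpecialLinearGroup (Fin 2) (ZMod 5)

abbrev P4 := ZMod 5 × ZMod 5 × ZMod 5 × ZMod 5

def P4.mul (x y : P4) : P4 :=
  (x.1 * y.1 + x.2.1 * y.2.2.1, x.1 * y.2.1 + x.2.1 * y.2.2.2,
    x.2.2.1 * y.1 + x.2.2.2 * y.2.2.1, x.2.2.1 * y.2.1 + x.2.2.2 * y.2.2.2)

def P4.det (x : P4) : ZMod 5 := x.1 * x.2.2.2 - x.2.1 * x.2.2.1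

def P4.sig (x : P4) : P4 := (x.2.2.2, 3 * x.2.2.1, 2 * x.2.1, x.1)

def toP (M : SL25) : P4 := (M.1 0 0, M.1 0 1, M.1 1 0, M.1 1 1)

def ofP (x : P4) (h : x.det = 1) : SL25 :=
  ⟨!![x.1, x.2.1; x.2.2.1, x.2.2.2], by rw [Matrix.det_fin_two_of]; exact h⟩

theorem toP_ofP (x : P4) (h : x.det = 1) : toP (ofP x h) = x := rfl

theorem toP_inj {A B : SL25} (h : toP A = toP B) : A = B := by
  simp only [toP, Prod.mk.injEq] at h
  obtain ⟨h1, h2, h3, h4⟩ := h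
  apply Subtype.ext
  ext i j
  fin_cases i <;> fin_cases j <;> assumption

theorem toP_mul (A B : SL25) : toP (A * B) = (toP A).mul (toP B) := by
  simp [toP, P4.mul, Matrix.mul_apply, Fin.sum_univ_two]

theorem toP_one : toP 1 = (1, 0, 0, 1) := by
  simp [toP]

theorem det_toP (A : SL25) : (toP A).det = 1 := by
  have := A.2
  rw [Matrix.det_fin_two] at this
  exact this

theorem toP_ne {A B : SL25} (h : A ≠ B) : toP A ≠ toP B := fun h' => h (toP_inj h')

theorem sig_mul : ∀ x y : P4, (x.mul y).sig = x.sig.mul y.sig := by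
  rintro ⟨a, b, c, d⟩ ⟨a', b', c', d'⟩
  have h5 : (5 : ZMod 5) = 0 := rfl
  simp only [P4.sig, P4.mul, Prod.mk.injEq]
  refine ⟨?_, ?_, ?_, ?_⟩
  · linear_combination (-c * b') * h5
  · ring
  · ring
  · linear_combination (-b * c') * h5

theorem sig_det : ∀ x : P4, x.sig.det = x.det := by
  rintro ⟨a, b, c, d⟩
  have h5 : (5 : ZMod 5) = 0 := rfl
  simp only [P4.sig, P4.det]
  linear_combination (-c * b) * h5

/-- conjugation by `!![0,1;2,0]` -/
def sigma : SL25 →* SL25 where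
  toFun M := ofP (toP M).sig (by rw [sig_det, det_toP])
  map_one' := toP_inj (by rw [toP_ofP, toP_one]; decide)
  map_mul' A B := toP_inj (by simp only [toP_mul, toP_ofP, sig_mul])

theorem toP_sigma (M : SL25) : toP (sigma M) = (toP M).sig := rfl

def mT : SL25 := ofP (1, 1, 0, 1) (by decide)
def mU : SL25 := ofP (1, 0, 1, 1) (by decide)
def mA : SL25 := ofP (0, 1, 4, 0) (by decide)
def mY : SL25 := ofP (3, 2, 4, 3) (by decide)
def mJ : SL25 := ofP (4, 0, 0, 4) (by decide)

theorem gen_P : ∀ a b c d : ZMod 5, P4.det (a, b, c, d) = 1 →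
    ∃ l i j k : ZMod 5, (a, b, c, d) =
      P4.mul (P4.mul (P4.mul (1, i, 0, 1) (1, 0, j, 1)) (1, k, 0, 1)) (1, 0, l, 1) := by
  decide +kernel

theorem T_pow (i : ZMod 5) (h) : ofP (1, i, 0, 1) h = mT ^ i.val := by
  apply toP_inj
  have : ∀ n : ℕ, toP (mT ^ n) = (1, (n : ZMod 5), 0, 1) := by
    intro n
    induction n with
    | zero => simp [toP_one]
    | succ n ih => rw [pow_succ, toP_mul, ih, mT, toP_ofP]; simp [P4.mul, add_comm]
  rw [this, toP_ofP, ZMod.natCast_zmod_val]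

theorem U_pow (i : ZMod 5) (h) : ofP (1, 0, i, 1) h = mU ^ i.val := by
  apply toP_inj
  have : ∀ n : ℕ, toP (mU ^ n) = (1, 0, (n : ZMod 5), 1) := by
    intro n
    induction n with
    | zero => simp [toP_one]
    | succ n ih => rw [pow_succ, toP_mul, ih, mU, toP_ofP]; simp [P4.mul]
  rw [this, toP_ofP, ZMod.natCast_zmod_val]

theorem gen_top (K : Subgroup SL25) (hT : mT ∈ K) (hU : mU ∈ K) (M : SL25) : M ∈ K := by
  obtain ⟨l, i, j, k, h⟩ := gen_P _ _ _ _ (det_toP M)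
  have hT1 : ∀ i : ZMod 5, P4.det (1, i, 0, 1) = 1 := by decide
  have hU1 : ∀ i : ZMod 5, P4.det (1, 0, i, 1) = 1 := by decide
  have : M = ofP (1, i, 0, 1) (hT1 i) * ofP (1, 0, j, 1) (hU1 j) * ofP (1, k, 0, 1) (hT1 k)
      * ofP (1, 0, l, 1) (hU1 l) := by
    apply toP_inj
    simp only [toP_mul, toP_ofP]
    exact h
  rw [this, T_pow, T_pow, U_pow, U_pow]
  exact K.mul_mem (K.mul_mem (K.mul_mem (K.pow_mem hT _) (K.pow_mem hU _)) (K.pow_mem hT _))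
    (K.pow_mem hU _)

theorem card_SL25 : Nat.card SL25 = 120 := by
  let E : SL25 ≃ {x : P4 // x.det = 1} :=
    { toFun := fun M => ⟨toP M, det_toP M⟩
      invFun := fun x => ofP x.1 x.2
      left_inv := fun M => toP_inj rfl
      right_inv := fun x => rfl }
  rw [Nat.card_congr E, Nat.card_eq_fintype_card]
  decide +kernel

/-! ### Automorphisms of `SL(2,5)` -/

set_option synthInstance.maxHeartbeats 400000 in
set_option synthInstance.maxSize 4096 in
theorem conj_P : ∀ a b c d : ZMod 5, P4.det (a, b, c, d) = 1 →
    P4.mul (P4.mul (P4.mul (P4.mul (a, b, c, d) (a, b, c, d)) (a, b, c, d)) (a, b, c, d))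
      (a, b, c, d) = (1, 0, 0, 1) → (a, b, c, d) ≠ (1, 0, 0, 1) →
    ∃ p q r s : ZMod 5, P4.det (p, q, r, s) = 1 ∧ (P4.mul (p, q, r, s) (a, b, c, d) = P4.mul (1, 1, 0, 1) (p, q, r, s) ∨
      P4.mul (p, q, r, s) (a, b, c, d) = P4.mul (1, 0, 2, 1) (p, q, r, s)) := by
  decide +kernel

set_option synthInstance.maxHeartbeats 400000 in
set_option synthInstance.maxSize 4096 in
theorem braid_T : ∀ a b c d : ZMod 5, P4.det (a, b, c, d) = 1 →
    P4.mul (P4.mul (1, 1, 0, 1) (a, b, c, d)) (1, 1, 0, 1) =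
      P4.mul (P4.mul (a, b, c, d) (1, 1, 0, 1)) (a, b, c, d) →
    (a, b, c, d) ≠ (1, 1, 0, 1) →
    ∃ p q r s : ZMod 5, P4.det (p, q, r, s) = 1 ∧ P4.mul (p, q, r, s) (1, 1, 0, 1) = P4.mul (1, 1, 0, 1) (p, q, r, s) ∧
      P4.mul (p, q, r, s) (a, b, c, d) = P4.mul (1, 0, 4, 1) (p, q, r, s) := by
  decide +kernel

set_option synthInstance.maxHeartbeats 400000 in
set_option synthInstance.maxSize 4096 in
theorem braid_U : ∀ a b c d : ZMod 5, P4.det (a, b, c, d) = 1 →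
    P4.mul (P4.mul (1, 0, 2, 1) (a, b, c, d)) (1, 0, 2, 1) =
      P4.mul (P4.mul (a, b, c, d) (1, 0, 2, 1)) (a, b, c, d) →
    (a, b, c, d) ≠ (1, 0, 2, 1) →
    ∃ p q r s : ZMod 5, P4.det (p, q, r, s) = 1 ∧ P4.mul (p, q, r, s) (1, 0, 2, 1) = P4.mul (1, 0, 2, 1) (p, q, r, s) ∧
      P4.mul (p, q, r, s) (a, b, c, d) = P4.mul (1, 2, 0, 1) (p, q, r, s) := by
  decide +kernel

set_option synthInstance.maxHeartbeats 400000 in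
set_option synthInstance.maxSize 4096 in
theorem cen_P : ∀ a b c d : ZMod 5, P4.det (a, b, c, d) = 1 →
      P4.mul (a, b, c, d) (1, 1, 0, 1) = P4.mul (1, 1, 0, 1) (a, b, c, d) →
      P4.mul (a, b, c, d) (1, 0, 1, 1) = P4.mul (1, 0, 1, 1) (a, b, c, d) →
      (a, b, c, d) = ((1, 0, 0, 1) : P4) ∨ (a, b, c, d) = ((4, 0, 0, 4) : P4) := by
  decide +kernel

def mV : SL25 := ofP (1, 0, 4, 1) (by decide)

theorem hom_eq {H : Type*} [Group H] (f g : SL25 →* H) (hT : f mT = g mT) (hV : f mV = g mV) :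
    ∀ M, f M = g M := by
  intro M
  refine gen_top (f.eqLocus g) hT ?_ M
  have : mU = mV ^ 4 := toP_inj (by
    simp only [pow_succ, pow_zero, one_mul, toP_mul, mU, mV, toP_ofP]; decide)
  rw [this]
  exact Subgroup.pow_mem _ (show mV ∈ f.eqLocus g from hV) 4

theorem aut_class (φ : SL25 ≃* SL25) :
    ∃ C : SL25, (∀ M, C * φ M * C⁻¹ = M) ∨ (∀ M, C * φ M * C⁻¹ = sigma M) := by
  have h5 : φ mT * φ mT * φ mT * φ mT * φ mT = 1 := by
    simp only [← map_mul]
    rw [← map_one φ]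
    congr 1
    apply toP_inj
    simp only [toP_mul, mT, toP_ofP, toP_one]; decide
  have hT1 : φ mT ≠ 1 := by
    rw [← map_one φ]
    intro h
    have := congrArg toP (φ.injective h)
    rw [toP_one, mT, toP_ofP] at this
    revert this; decide
  have h5' := congrArg toP h5
  simp only [toP_mul, toP_one] at h5'
  have hT1' := toP_ne hT1
  rw [toP_one] at hT1'
  obtain ⟨x₁, x₂, x₃, x₄, hx, hx'⟩ := conj_P _ _ _ _ (det_toP (φ mT)) h5' hT1'
  set X := ofP (x₁, x₂, x₃, x₄) hx with hX
  let ψ : SL25 ≃* SL25 := φ.trans (MulAut.conj X)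
  have hψ : ∀ M, ψ M = X * φ M * X⁻¹ := fun M => rfl
  have hbr : ψ mT * ψ mV * ψ mT = ψ mV * ψ mT * ψ mV := by
    simp only [← map_mul]
    congr 1
    apply toP_inj
    simp only [toP_mul, mT, mV, toP_ofP]; decide
  have hne : ψ mV ≠ ψ mT := by
    intro h
    have := congrArg toP (ψ.injective h)
    rw [mV, mT, toP_ofP, toP_ofP] at this
    revert this; decide
  have hbr' := congrArg toP hbr
  simp only [toP_mul] at hbr'
  have hne' := toP_ne hne
  have key : ∀ (S : SL25), X * φ mT = S * X → ψ mT = S := by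
    intro S h
    rw [hψ, h, mul_inv_cancel_right]
  rcases hx' with h | h
  · have hT : ψ mT = mT := key _ (toP_inj (by rw [toP_mul, toP_mul]; exact h))
    have e : toP (ψ mT) = (1, 1, 0, 1) := by rw [hT]; rfl
    rw [e] at hbr' hne'
    obtain ⟨y₁, y₂, y₃, y₄, hy, hy1, hy2⟩ := braid_T _ _ _ _ (det_toP (ψ mV)) hbr' hne'
    refine ⟨ofP (y₁, y₂, y₃, y₄) hy * X, Or.inl ?_⟩
    have := hom_eq ((ψ.trans (MulAut.conj (ofP (y₁, y₂, y₃, y₄) hy))).toMonoidHom) (MonoidHom.id _)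
      (by
        change ofP (y₁, y₂, y₃, y₄) hy * ψ mT * (ofP (y₁, y₂, y₃, y₄) hy)⁻¹ = mT
        rw [hT, mul_inv_eq_iff_eq_mul]
        apply toP_inj; rw [toP_mul, toP_mul]; exact hy1)
      (by
        change ofP (y₁, y₂, y₃, y₄) hy * ψ mV * (ofP (y₁, y₂, y₃, y₄) hy)⁻¹ = mV
        rw [mul_inv_eq_iff_eq_mul]
        apply toP_inj; rw [toP_mul, toP_mul]; exact hy2)
    intro M
    have h2 : ofP (y₁, y₂, y₃, y₄) hy * (X * φ M * X⁻¹) * (ofP (y₁, y₂, y₃, y₄) hy)⁻¹ = M := this M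
    refine Eq.trans ?_ h2
    group
  · have hT : ψ mT = sigma mT := key _ (toP_inj (by rw [toP_mul, toP_mul]; exact h))
    have e : toP (ψ mT) = (1, 0, 2, 1) := by rw [hT]; rfl
    rw [e] at hbr' hne'
    obtain ⟨y₁, y₂, y₃, y₄, hy, hy1, hy2⟩ := braid_U _ _ _ _ (det_toP (ψ mV)) hbr' hne'
    refine ⟨ofP (y₁, y₂, y₃, y₄) hy * X, Or.inr ?_⟩
    have := hom_eq ((ψ.trans (MulAut.conj (ofP (y₁, y₂, y₃, y₄) hy))).toMonoidHom) sigma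
      (by
        change ofP (y₁, y₂, y₃, y₄) hy * ψ mT * (ofP (y₁, y₂, y₃, y₄) hy)⁻¹ = sigma mT
        rw [hT, mul_inv_eq_iff_eq_mul]
        apply toP_inj; rw [toP_mul, toP_mul]; exact hy1)
      (by
        change ofP (y₁, y₂, y₃, y₄) hy * ψ mV * (ofP (y₁, y₂, y₃, y₄) hy)⁻¹ = sigma mV
        rw [mul_inv_eq_iff_eq_mul]
        apply toP_inj; rw [toP_mul, toP_mul]; exact hy2)
    intro M
    have h2 : ofP (y₁, y₂, y₃, y₄) hy * (X * φ M * X⁻¹) * (ofP (y₁, y₂, y₃, y₄) hy)⁻¹ = sigma M := this M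
    rw [← h2]
    group

/-! ### Generalized quaternion subgroups -/

theorem quat_sub {G : Type*} [Group G] (n : ℕ) (hn : 2 ≤ n) (a x : G) (ha : orderOf a = 2 * n)
    (hx : x ^ 2 = a ^ n) (hax : a * x * a = x) :
    ∃ H : Subgroup G, Nonempty (H ≃* QuaternionGroup n) ∧ a ∈ H ∧ x ∈ H ∧
      ∀ K : Subgroup G, a ∈ K → x ∈ K → H ≤ K := by
  have : NeZero n := ⟨by omega⟩
  have ha1 : a ^ (2 * n) = 1 := by rw [← ha]; exact pow_orderOf_eq_one a
  let q : ZMod (2 * n) →+ Additive G :=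
    ZMod.lift (2 * n) ⟨zmultiplesHom (Additive G) (Additive.ofMul a), by
      simp only [zmultiplesHom_apply, natCast_zsmul]
      exact ha1⟩
  let p : ZMod (2 * n) → G := fun i => (q i).toMul
  have hadd : ∀ i j, p (i + j) = p i * p j := fun i j => by simp [p]
  have hsub : ∀ i j, p (i - j) = p i * (p j)⁻¹ := fun i j => by simp [p, div_eq_mul_inv]
  have hp0 : p 0 = 1 := by simp [p]
  have hpn : ∀ k : ℕ, p (k : ZMod (2 * n)) = a ^ k := by
    intro k
    have := ZMod.lift_coe (2 * n) (A := Additive G) ⟨zmultiplesHom (Additive G) (Additive.ofMul a), by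
      simp only [zmultiplesHom_apply, natCast_zsmul]
      exact ha1⟩ (k : ℤ)
    simp only [zmultiplesHom_apply, natCast_zsmul, Int.cast_natCast] at this
    exact congrArg Additive.toMul this
  have hpv : ∀ i, p i = a ^ i.val := fun i => by rw [← hpn, ZMod.natCast_zmod_val]
  have hcom : ∀ i, p i * x * p i = x := by
    intro i
    rw [hpv]
    induction i.val with
    | zero => simp
    | succ k ih =>
      calc a ^ (k + 1) * x * a ^ (k + 1) = a ^ k * (a * x * a) * a ^ k := by
            nth_rewrite 1 [pow_succ]
            rw [pow_succ']
            simp only [mul_assoc]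
        _ = x := by rw [hax, ih]
  have hcom' : ∀ i, p i * x = x * (p i)⁻¹ := fun i => by
    rw [eq_mul_inv_iff_mul_eq]; exact hcom i
  have pcomm : ∀ i j, p i * p j = p j * p i := fun i j => by
    rw [← hadd, add_comm, hadd]
  have pcomm' : ∀ i j, (p i)⁻¹ * p j = p j * (p i)⁻¹ := fun i j => by
    have : Commute (p i) (p j) := pcomm i j
    exact this.inv_left
  let F : QuaternionGroup n →* G :=
    { toFun := fun g => match g with
        | .a i => p i
        | .xa i => x * p i
      map_one' := hp0
      map_mul' := by
        rintro (i | i) (j | j)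
        · simp only [QuaternionGroup.a_mul_a, hadd]
        · simp only [QuaternionGroup.a_mul_xa, hsub]
          rw [← mul_assoc (p i), hcom', mul_assoc x (p i)⁻¹, pcomm', ← mul_assoc]
        · simp only [QuaternionGroup.xa_mul_a, hadd, mul_assoc]
        · simp only [QuaternionGroup.xa_mul_xa, hsub, hadd, hpn]
          rw [← hx, mul_assoc x, ← mul_assoc (p i), hcom', mul_assoc x, pcomm', ← mul_assoc,
            ← mul_assoc, sq] }
  have hFa : ∀ i, F (.a i) = p i := fun i => rfl
  have hFx : ∀ i, F (.xa i) = x * p i := fun i => rfl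
  have hinj : Function.Injective F := by
    rw [injective_iff_map_eq_one]
    rintro (i | i) h
    · rw [hFa, hpv] at h
      have h1 := orderOf_dvd_of_pow_eq_one h
      rw [ha] at h1
      have h2 := Nat.eq_zero_of_dvd_of_lt h1 (ZMod.val_lt i)
      rw [ZMod.val_eq_zero] at h2
      rw [h2]; rfl
    · exfalso
      rw [hFx] at h
      have hx1 : x = (p i)⁻¹ := eq_inv_of_mul_eq_one_left h
      have hc : a * x = x * a := by
        have h1 : p 1 = a := by
          have := hpn 1
          simpa using this
        rw [hx1, ← h1, pcomm']
      have h2 : a ^ 2 = 1 := by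
        have := hax
        rw [hc, mul_assoc, ← sq] at this
        exact mul_eq_left.mp this
      have h1 := Nat.le_of_dvd (by norm_num) (orderOf_dvd_of_pow_eq_one h2)
      omega
  refine ⟨F.range, ⟨(MonoidHom.ofInjective hinj).symm⟩, ⟨.a 1, ?_⟩, ⟨.xa 0, ?_⟩, ?_⟩
  · rw [hFa]; simpa using hpn 1
  · rw [hFx, hp0, mul_one]
  · rintro K hKa hKx _ ⟨i | i, rfl⟩
    · rw [hFa, hpv]; exact K.pow_mem hKa _
    · rw [hFx, hpv]; exact K.mul_mem hKx (K.pow_mem hKa _)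

set_option maxRecDepth 4000 in
/-- If `G` has order 240, exactly one element of order 2, and a normal subgroup `N`
isomorphic to `SL(2,5)` (i.e. `G` is the non-split extension `SL(2,5).C₂`), then there
are subgroups `H₁ ≅ Q₁₆` (`QuaternionGroup 4`) and `H₂ ≅ Dic₆ = [24,4]`
(`QuaternionGroup 6`) such that `H₁ ∩ H₂` contains a subgroup isomorphic to the
quaternion group `Q₈` (`QuaternionGroup 2`) and `H₁` and `H₂` generate `G`. -/
theorem stmt11 {G : Type*} [Group G] [Finite G]
    (hcard : Nat.card G = 240)
    (huniq : ∃! g : G, orderOf g = 2)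
    (N : Subgroup G) (hN : N.Normal)
    (hiso : Nonempty (N ≃* Matrix.SpecialLinearGroup (Fin 2) (ZMod 5))) :
    ∃ H₁ H₂ : Subgroup G,
      Nonempty (H₁ ≃* QuaternionGroup 4) ∧
      Nonempty (H₂ ≃* QuaternionGroup 6) ∧
      (∃ Q : Subgroup G, Q ≤ H₁ ⊓ H₂ ∧ Nonempty (Q ≃* QuaternionGroup 2)) ∧
      H₁ ⊔ H₂ = ⊤ := by
  obtain ⟨e⟩ := hiso
  obtain ⟨u, hu, huu⟩ := huniq
  let f : SL25 →* G := N.subtype.comp e.symm.toMonoidHom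
  have hf : Function.Injective f := Subtype.val_injective.comp e.symm.injective
  have hfN : ∀ M, f M ∈ N := fun M => (e.symm M).2
  have hNf : ∀ g ∈ N, ∃ M, f M = g := fun g hg => ⟨e ⟨g, hg⟩, by simp [f]⟩
  have hcN : Nat.card N = 120 := (Nat.card_congr e.toEquiv).trans card_SL25
  have hidx : N.index = 2 := by
    have := N.card_mul_index
    rw [hcN, hcard] at this
    omega
  have hJ2 : mJ * mJ = 1 := toP_inj (by rw [toP_mul, toP_one]; decide)
  have hJ1 : mJ ≠ 1 := fun h => by
    have := congrArg toP h
    rw [toP_one] at this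
    revert this; decide
  have hfJ1 : f mJ ≠ 1 := fun h => hJ1 (hf (h.trans (map_one f).symm))
  -- every square root of one lies in `N`
  have hinv : ∀ g : G, g * g = 1 → g ∈ N := by
    intro g hg
    by_cases h1 : g = 1
    · rw [h1]; exact N.one_mem
    have o1 : orderOf g = 2 := orderOf_eq_prime (by rw [sq, hg]) h1
    have o2 : orderOf (f mJ) = 2 := orderOf_eq_prime (by rw [sq, ← map_mul, hJ2, map_one]) hfJ1
    rw [(huu g o1).trans (huu _ o2).symm]
    exact hfN _
  obtain ⟨t0, ht0⟩ : ∃ t0, t0 ∉ N := by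
    by_contra hcon
    push Not at hcon
    have : N = ⊤ := (Subgroup.eq_top_iff' N).2 hcon
    rw [this, Subgroup.index_top] at hidx
    omega
  let φ : SL25 ≃* SL25 := (e.symm.trans (MulAut.conjNormal t0)).trans e
  have hφ : ∀ M, f (φ M) = t0 * f M * t0⁻¹ := by
    intro M
    simp [f, φ, MulAut.conjNormal_apply]
  obtain ⟨C, hC⟩ := aut_class φ
  set t := f C * t0 with ht
  have htN : t ∉ N := fun h => ht0 ((N.mul_mem_cancel_left (hfN C)).1 h)
  have htc : ∀ M, t * f M * t⁻¹ = f (C * φ M * C⁻¹) := by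
    intro M
    rw [map_mul, map_mul, hφ, map_inv, ht]
    group
  have htt : t * t ∈ N := Subgroup.mul_self_mem_of_index_two hidx t
  obtain ⟨S, hS⟩ := hNf _ htt
  have cenS : (∀ M, C * φ (C * φ M * C⁻¹) * C⁻¹ = M) → t * t = f mJ := by
    intro h
    have hcm : ∀ M, S * M = M * S := by
      intro M
      apply hf
      rw [map_mul, map_mul, hS]
      have := htc (C * φ M * C⁻¹)
      rw [h, ← htc] at this
      calc t * t * f M = t * (t * f M * t⁻¹) * t⁻¹ * (t * t) := by group
        _ = f M * (t * t) := by rw [this]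
    have c1 := congrArg toP (hcm mT)
    have c2 := congrArg toP (hcm mU)
    rw [toP_mul, toP_mul] at c1 c2
    rcases cen_P _ _ _ _ (det_toP S) c1 c2 with h' | h'
    · exfalso
      have : S = 1 := toP_inj (by rw [toP_one]; exact h')
      rw [this, map_one] at hS
      exact htN (hinv t hS.symm)
    · have : S = mJ := toP_inj h'
      rw [← hS, this]
  rcases hC with hC | hC
  · -- the inner case is impossible
    exfalso
    have h1 := cenS (fun M => by rw [hC, hC])
    have h2 : t * f mA = f mA * t := by
      have := htc mA
      rw [hC, mul_inv_eq_iff_eq_mul] at this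
      exact this
    have h3 : mA * mA * mJ = 1 := toP_inj (by simp only [toP_mul, toP_one]; decide)
    have h4 : f mA * t ∈ N := by
      apply hinv
      rw [mul_assoc, ← mul_assoc t, h2, mul_assoc, h1, ← mul_assoc, ← map_mul, ← map_mul, h3,
        map_one]
    exact htN ((N.mul_mem_cancel_left (hfN mA)).1 h4)
  have hss : ∀ M, sigma (sigma M) = M := by
    have h : ∀ a b c d : ZMod 5, P4.sig (P4.sig (a, b, c, d)) = (a, b, c, d) := by decide
    intro M
    apply toP_inj
    exact h _ _ _ _
  have htt2 := cenS (fun M => by rw [hC, hC, hss])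
  have htm : ∀ M, t * f M = f (sigma M) * t := by
    intro M
    have := htc M
    rw [hC, mul_inv_eq_iff_eq_mul] at this
    exact this
  -- multiplication rules
  have r1 : ∀ A B, (f A * t) * (f B * t) = f (A * sigma B * mJ) := by
    intro A B
    rw [mul_assoc, ← mul_assoc t, htm, mul_assoc, htt2, ← mul_assoc, ← map_mul, ← map_mul]
  have r2 : ∀ A B, (f A * t) * f B = f (A * sigma B) * t := by
    intro A B
    rw [mul_assoc, htm, ← mul_assoc, ← map_mul]
  have r3 : ∀ A B, f A * (f B * t) = f (A * B) * t := by
    intro A B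
    rw [← mul_assoc, ← map_mul]
  set a := f mA * t with ha
  set y := f mY * t with hy
  have t1 : t = f 1 * t := by rw [map_one, one_mul]
  set z : SL25 := mA * sigma mA * mJ with hz
  have ha2 : a ^ 2 = f z := by rw [sq, ha, r1]
  have hz2 : z * z = mJ := toP_inj (by simp only [hz, toP_mul, toP_sigma]; decide)
  have ha4 : a ^ 4 = f mJ := by
    rw [show 4 = 2 * 2 from rfl, pow_mul, ha2, sq, ← map_mul, hz2]
  have ha8 : a ^ 8 = 1 := by
    rw [show 8 = 4 * 2 from rfl, pow_mul, ha4, sq, ← map_mul, hJ2, map_one]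
  have hat : a * t * a = t := by
    have : mA * sigma 1 * mJ * mA = 1 := toP_inj (by
      simp only [toP_mul, toP_sigma, toP_one]; decide)
    conv_lhs => rw [t1]
    rw [ha, r1, r3, this, map_one, one_mul]
  have hy2 : y ^ 2 = f (mY * sigma mY * mJ) := by rw [sq, hy, r1]
  have hy3 : y ^ 3 = t := by
    have : mY * sigma mY * mJ * mY = 1 := toP_inj (by
      simp only [toP_mul, toP_sigma, toP_one]; decide)
    rw [pow_succ, hy2, hy, r3, this, map_one, one_mul]
  have hy6 : y ^ 6 = f mJ := by
    rw [show 6 = 3 * 2 from rfl, pow_mul, hy3, sq, htt2]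
  have hy12 : y ^ 12 = 1 := by
    rw [show 12 = 6 * 2 from rfl, pow_mul, hy6, sq, ← map_mul, hJ2, map_one]
  have hy4 : y ^ 4 ≠ 1 := by
    rw [show 4 = 2 * 2 from rfl, pow_mul, hy2, sq, ← map_mul]
    intro h
    have := congrArg toP (hf (h.trans (map_one f).symm))
    simp only [toP_mul, toP_sigma, toP_one] at this
    revert this; decide
  have hyz : y * f z * y = f z := by
    have : mY * sigma z * sigma mY * mJ = z := toP_inj (by
      simp only [hz, map_mul, toP_mul, toP_sigma]; decide)
    rw [hy, r2, r1, this]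
  have oa : orderOf a = 2 * 4 :=
    orderOf_eq_prime_pow (p := 2) (n := 2) (x := a) (by
      rw [show 2 ^ 2 = 4 from rfl, ha4]; exact hfJ1) ha8
  have oy : orderOf y = 2 * 6 := by
    apply orderOf_eq_of_pow_and_pow_div_prime (by norm_num) hy12
    intro p hp hpd
    have hp' : p ∣ 2 ^ 2 * 3 := hpd
    rcases (Nat.Prime.dvd_mul hp).1 hp' with h | h
    · have := (Nat.prime_dvd_prime_iff_eq hp Nat.prime_two).1 (hp.dvd_of_dvd_pow h)
      subst this
      change y ^ 6 ≠ 1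
      rw [hy6]; exact hfJ1
    · have := (Nat.prime_dvd_prime_iff_eq hp Nat.prime_three).1 h
      subst this
      exact hy4
  have oz : orderOf (f z) = 2 * 2 :=
    orderOf_eq_prime_pow (p := 2) (n := 1) (by
      rw [pow_one, sq, ← map_mul, hz2]; exact hfJ1) (by
      change f z ^ 4 = 1
      rw [← ha2, ← pow_mul]; exact ha8)
  have hzt : f z * t * f z = t := by
    rw [← ha2, sq]
    calc a * a * t * (a * a) = a * (a * t * a) * a := by simp only [mul_assoc]
      _ = t := by rw [hat, hat]
  obtain ⟨H₁, i1, m1, m1', -⟩ := quat_sub 4 (by norm_num) a t oa (by rw [sq, htt2, ha4]) hat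
  obtain ⟨H₂, i2, m2, m2', -⟩ := quat_sub 6 (by norm_num) y (f z) oy
    (by rw [sq, ← map_mul, hz2, hy6]) hyz
  obtain ⟨Q, i3, -, -, hQ⟩ := quat_sub 2 (by norm_num) (f z) t oz
    (by rw [sq, htt2, sq, ← map_mul, hz2]) hzt
  refine ⟨H₁, H₂, i1, i2, ⟨Q, hQ _ ⟨?_, m2'⟩ ⟨m1', ?_⟩, i3⟩, ?_⟩
  · rw [← ha2]; exact H₁.pow_mem m1 2
  · rw [← hy3]; exact H₂.pow_mem m2 3
  set K := H₁ ⊔ H₂ with hK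
  have kt : t ∈ K := (le_sup_left : H₁ ≤ K) m1'
  have ka : f mA ∈ K := (K.mul_mem_cancel_right kt).1 ((le_sup_left : H₁ ≤ K) m1)
  have ky : f mY ∈ K := (K.mul_mem_cancel_right kt).1 ((le_sup_right : H₂ ≤ K) m2)
  have kb : f (sigma mA) ∈ K := by
    refine (K.mul_mem_cancel_right kt).1 ?_
    rw [← htm]; exact K.mul_mem kt ka
  have kT : mT ∈ K.comap f := by
    have : mT = mY * sigma mA * mY := toP_inj (by simp only [toP_mul, toP_sigma]; decide)
    rw [this]
    exact mul_mem (mul_mem ky kb) ky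
  have kU : mU ∈ K.comap f := by
    have : mU = mA * mY * mY * mA * mY * sigma mA :=
      toP_inj (by simp only [toP_mul, toP_sigma]; decide +kernel)
    rw [this]
    exact mul_mem (mul_mem (mul_mem (mul_mem (mul_mem ka ky) ky) ka) ky) kb
  have kN : ∀ g ∈ N, g ∈ K := by
    intro g hg
    obtain ⟨M, rfl⟩ := hNf g hg
    exact gen_top (K.comap f) kT kU M
  rw [Subgroup.eq_top_iff']
  intro g
  by_cases hg : g ∈ N
  · exact kN g hg
  · refine (K.mul_mem_cancel_right kt).1 (kN _ ?_)
    exact (Subgroup.mul_mem_iff_of_index_two hidx).2 (by tauto)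
end
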